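/- There exist absolute constants δ₀ > 0 and C > 0 such that for all 2 ≤ y ≤ x, all 0 ≤ δ ≤ δ₀ and all (σ,κ) ∈ D_δ(α;y): |∂₂₀f_y(σ,κ) + ∂₁₁f_y(σ,κ) − σ₂/2| ≤ C δ σ₂ and |Hess[f_y](σ,κ) − (σ₂/4)(σ₂ − σ̃₂/3)| ≤ C δ σ₂², where Hess[f_y] := (∂₂₀f_y)(∂₀₂f_y) − (∂₁₁f_y)². -/

import Mathlib

open Complex Finset MeasureTheory
open scoped Real Classical

noncomputable section

/-- The set of primes `p ≤ y`. -/
def primesLe (y : ℝ) : Finset ℕ := (Finset.Iic ⌊y⌋₊).filter Nat.Prime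

/-- `α` satisfies the saddle-point equation `∑_{p ≤ y} log p/(p^α − 1) = log x`. -/
def saddleEq (x y α : ℝ) : Prop :=
  ∑ p ∈ primesLe y, Real.log p / ((p : ℝ) ^ α - 1) = Real.log x

/-- `ū = min{u, π(y)}` where `u = log x/log y`. -/
def ubar (x y : ℝ) : ℝ := min (Real.log x / Real.log y) ((primesLe y).card)

def sigma2 (y α : ℝ) : ℝ :=
  ∑ p ∈ primesLe y, (Real.log p) ^ 2 * (p : ℝ) ^ α / ((p : ℝ) ^ α - 1) ^ 2

def sigma2t (y α : ℝ) : ℝ :=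
  ∑ p ∈ primesLe y, (Real.log p) ^ 2 / ((p : ℝ) ^ α - 1) ^ 2

/-- `ϱ = (1/2)(σ₂ − σ̃₂/3)^{1/2}`. -/
def rhoXY (y α : ℝ) : ℝ := (1 / 2) * Real.sqrt (sigma2 y α - sigma2t y α / 3)

/-- `n` is `y`-friable: every prime factor of `n` is at most `y`. -/
def friable (y : ℝ) (n : ℕ) : Prop := ∀ p : ℕ, p.Prime → p ∣ n → (p : ℝ) ≤ y

/-- `S(x,y)`: the set of `y`-friable integers `1 ≤ n ≤ x`. -/
def Sxy (x y : ℝ) : Finset ℕ := (Finset.Icc 1 ⌊x⌋₊).filter (friable y)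

/-- `Ψ(x,y) = #S(x,y)`. -/
def Psi (x y : ℝ) : ℕ := (Sxy x y).card

/-- `D(x,y;γ) = Ψ(x,y)⁻¹ ∑_{n ∈ S(x,y)} τ(n)⁻¹ #{d ∣ n : d ≥ √n e^γ}`. -/
def Dxy (x y γ : ℝ) : ℝ :=
  (Psi x y : ℝ)⁻¹ * ∑ n ∈ Sxy x y,
    ((n.divisors.card : ℝ))⁻¹ *
      ((n.divisors.filter (fun d => Real.sqrt n * Real.exp γ ≤ (d : ℝ))).card : ℝ)

/-- `Φ(v) = ∫_v^∞ e^{-z²/2} dz/√(2π)`. -/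
def PhiGauss (v : ℝ) : ℝ :=
  ∫ z in Set.Ioi v, Real.exp (-z ^ 2 / 2) / Real.sqrt (2 * Real.pi)

/-- `g(z) = log((z^{1/2} − z^{-1/2})/log z)`, with `g(1) = 0`. -/
def gfun (z : ℂ) : ℂ :=
  if z = 1 then 0
  else Complex.log ((z ^ (2⁻¹ : ℂ) - z ^ (-2⁻¹ : ℂ)) / Complex.log z)

/-- `Ξ(a,b) = −(1/2)log(1−a) − (1/2)log(1−b) − g((1−a)/(1−b))`. -/
def Xi (a b : ℂ) : ℂ :=
  -(2⁻¹ : ℂ) * Complex.log (1 - a) - (2⁻¹ : ℂ) * Complex.log (1 - b) -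
    gfun ((1 - a) / (1 - b))

/-- `f_y(s,w) = ∑_{p ≤ y} Ξ(p^{-s}, p^{-w})`. -/
def fy (y : ℝ) (s w : ℂ) : ℂ := ∑ p ∈ primesLe y, Xi ((p : ℂ) ^ (-s)) ((p : ℂ) ^ (-w))

/-- `F_y(s,w) = exp(f_y(s,w))`. -/
def Fy (y : ℝ) (s w : ℂ) : ℂ := Complex.exp (fy y s w)

/-- `F_y(σ,κ)` at real arguments, as a (positive) real number. -/
def FyR (y σ κ : ℝ) : ℝ := Real.exp ((fy y (σ : ℂ) (κ : ℂ)).re)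

/-- `∂_{kℓ}f(s,w)`: partial derivative `k` times in the first variable and `ℓ` times
in the second. -/
def pdv (k l : ℕ) (f : ℂ → ℂ → ℂ) (s w : ℂ) : ℂ :=
  iteratedDeriv k (fun z => iteratedDeriv l (f z) w) s

/-- `Hess[f_y] = (∂₂₀f_y)(∂₀₂f_y) − (∂₁₁f_y)²`. -/
def HessC (y : ℝ) (s w : ℂ) : ℂ :=
  pdv 2 0 (fy y) s w * pdv 0 2 (fy y) s w - (pdv 1 1 (fy y) s w) ^ 2

/-- The domain `D_δ(α;y)`. -/
def Ddom (δ α y : ℝ) : Set (ℝ × ℝ) :=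
  {p | 0 < p.1 ∧ p.1 ≤ 1 ∧ 0 < p.2 ∧ p.2 ≤ 1 ∧ 0 ≤ (p.1 - α) * (α - p.2) ∧
    1 / (1 + δ) ≤ (1 - (2 : ℝ) ^ (-p.1)) / (1 - (2 : ℝ) ^ (-p.2)) ∧
    (1 - (2 : ℝ) ^ (-p.1)) / (1 - (2 : ℝ) ^ (-p.2)) ≤ 1 + δ ∧
    |p.1 - p.2| * Real.log y ≤ δ}

/-- `φ_k(s,y)`: the `k`-th derivative in `s` of `φ₀(s,y) = −∑_{p ≤ y} log(1−p^{-s})`. -/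
def phiD (y : ℝ) (k : ℕ) (s : ℂ) : ℂ :=
  iteratedDeriv k (fun z => -∑ p ∈ primesLe y, Complex.log (1 - (p : ℂ) ^ (-z))) s

/-- `φ₂(σ,y) = ∑_{p ≤ y} (log p)² p^σ/(p^σ−1)²` for real `σ`. -/
def phi2R (y σ : ℝ) : ℝ :=
  ∑ p ∈ primesLe y, (Real.log p) ^ 2 * (p : ℝ) ^ σ / ((p : ℝ) ^ σ - 1) ^ 2


/-- The entire function `t ↦ (e^{t/2} - e^{-t/2})/t`. -/
def sinhQuot : ℂ → ℂ := dslope (fun t => exp (t / 2) - exp (-(t / 2))) 0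

theorem differentiable_sinhQuot : Differentiable ℂ sinhQuot := by
  rw [← differentiableOn_univ]
  refine (Complex.differentiableOn_dslope Filter.univ_mem).2 ?_
  exact Differentiable.differentiableOn (by fun_prop)

theorem mul_sinhQuot (t : ℂ) : t * sinhQuot t = exp (t / 2) - exp (-(t / 2)) := by
  have h := sub_smul_dslope (fun t : ℂ => exp (t / 2) - exp (-(t / 2))) 0 t
  simpa [sinhQuot] using h

theorem hasDerivAt_exp_half (t : ℂ) : HasDerivAt (fun t : ℂ => exp (t / 2)) (exp (t / 2) / 2) t := by
  simpa [div_eq_mul_inv] using ((hasDerivAt_id t).div_const 2).cexp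

theorem hasDerivAt_exp_neg_half (t : ℂ) :
    HasDerivAt (fun t : ℂ => exp (-(t / 2))) (-(exp (-(t / 2)) / 2)) t := by
  simpa [div_eq_mul_inv] using ((hasDerivAt_id t).div_const 2).neg.cexp

theorem differentiable_deriv_sinhQuot : Differentiable ℂ (deriv sinhQuot) :=
  differentiable_sinhQuot.deriv

theorem differentiable_deriv_deriv_sinhQuot : Differentiable ℂ (deriv (deriv sinhQuot)) :=
  differentiable_deriv_sinhQuot.deriv

theorem sinhQuot_add_mul_deriv (t : ℂ) :
    sinhQuot t + t * deriv sinhQuot t = (exp (t / 2) + exp (-(t / 2))) / 2 := by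
  have h1 := (hasDerivAt_id t).mul (differentiable_sinhQuot t).hasDerivAt
  have h2 := (hasDerivAt_exp_half t).sub (hasDerivAt_exp_neg_half t)
  have h3 := h1.congr_of_eventuallyEq (f₁ := fun t => exp (t / 2) - exp (-(t / 2)))
    (Filter.Eventually.of_forall fun z => (mul_sinhQuot z).symm)
  have h4 := h3.unique h2
  simp only [id] at h4
  linear_combination h4

theorem two_mul_deriv_sinhQuot_add (t : ℂ) :
    2 * deriv sinhQuot t + t * deriv (deriv sinhQuot) t =
      (exp (t / 2) - exp (-(t / 2))) / 4 := by
  have h1 := (differentiable_sinhQuot t).hasDerivAt.add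
    ((hasDerivAt_id t).mul (differentiable_deriv_sinhQuot t).hasDerivAt)
  have h2 := ((hasDerivAt_exp_half t).add (hasDerivAt_exp_neg_half t)).div_const 2
  have h3 := h1.congr_of_eventuallyEq (f₁ := fun t => (exp (t / 2) + exp (-(t / 2))) / 2)
    (Filter.Eventually.of_forall fun z => (sinhQuot_add_mul_deriv z).symm)
  have h4 := h3.unique h2
  simp only [id] at h4
  linear_combination h4

theorem sinhQuot_zero : sinhQuot 0 = 1 := by
  have h := sinhQuot_add_mul_deriv 0
  norm_num at h
  exact h

theorem deriv_sinhQuot_zero : deriv sinhQuot 0 = 0 := by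
  have h := two_mul_deriv_sinhQuot_add 0
  norm_num at h
  exact h

theorem deriv_deriv_sinhQuot_zero : deriv (deriv sinhQuot) 0 = 1 / 12 := by
  have h1 := ((differentiable_deriv_sinhQuot 0).hasDerivAt.const_mul 2).add
    ((hasDerivAt_id 0).mul (differentiable_deriv_deriv_sinhQuot 0).hasDerivAt)
  have h2 := ((hasDerivAt_exp_half 0).sub (hasDerivAt_exp_neg_half 0)).div_const 4
  have h3 := h1.congr_of_eventuallyEq (f₁ := fun t => (exp (t / 2) - exp (-(t / 2))) / 4)
    (Filter.Eventually.of_forall fun z => (two_mul_deriv_sinhQuot_add z).symm)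
  have h4 := h3.unique h2
  norm_num at h4
  linear_combination h4 / 3

theorem gfun_exp_of_norm_lt {t : ℂ} (ht : ‖t‖ < 1) : gfun (exp t) = log (sinhQuot t) := by
  have him : |t.im| < 1 := (Complex.abs_im_le_norm t).trans_lt ht
  have hlog : log (exp t) = t := by
    rw [abs_lt] at him
    exact Complex.log_exp (by linarith [Real.pi_gt_three]) (by linarith [Real.pi_gt_three])
  by_cases h0 : t = 0
  · simp [h0, gfun, sinhQuot_zero]
  have h1 : exp t ≠ 1 := fun h => h0 (by rw [← hlog, h, Complex.log_one])
  rw [gfun, if_neg h1, Complex.cpow_def_of_ne_zero (exp_ne_zero t),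
    Complex.cpow_def_of_ne_zero (exp_ne_zero t), hlog]
  congr 1
  rw [div_eq_iff h0, mul_comm (sinhQuot t), mul_sinhQuot]
  congr 2
  ring

/-- Second-order control of `t ↦ g(e^t)` around `0`. -/
theorem exists_derivs_gfun_exp :
    ∃ r > (0 : ℝ), ∃ K ≥ (0 : ℝ), ∃ h1 h2 : ℂ → ℂ, ∀ t : ℂ, ‖t‖ < r →
      HasDerivAt (fun t => gfun (exp t)) (h1 t) t ∧ HasDerivAt h1 (h2 t) t ∧
      ‖h1 t‖ ≤ K * ‖t‖ ∧ ‖h2 t - 1 / 12‖ ≤ K * ‖t‖ := by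
  set h1 : ℂ → ℂ := fun t => deriv sinhQuot t / sinhQuot t with hh1
  set h2 : ℂ → ℂ := fun t => (deriv (deriv sinhQuot) t * sinhQuot t -
    deriv sinhQuot t * deriv sinhQuot t) / sinhQuot t ^ 2 with hh2
  have hq0 : sinhQuot 0 ≠ 0 := by simp [sinhQuot_zero]
  have d0 := differentiable_sinhQuot 0
  have d1 := differentiable_deriv_sinhQuot 0
  have d2 := differentiable_deriv_deriv_sinhQuot 0
  have hO1 := (d1.div d0 hq0).isBigO_sub
  have hO2 := (((d2.mul d0).sub (d1.mul d1)).div (d0.pow 2) (pow_ne_zero 2 hq0)).isBigO_sub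
  obtain ⟨K1, hK1p, hK1⟩ := hO1.exists_pos
  obtain ⟨K2, hK2p, hK2⟩ := hO2.exists_pos
  have hslit : ∀ᶠ t in nhds (0 : ℂ), sinhQuot t ∈ slitPlane :=
    d0.continuousAt.eventually_mem
      (Complex.isOpen_slitPlane.mem_nhds (by simp [sinhQuot_zero]))
  obtain ⟨r, hr, hball⟩ := Metric.eventually_nhds_iff.1 (hslit.and (hK1.bound.and hK2.bound))
  refine ⟨min r 1, lt_min hr one_pos, max K1 K2, hK1p.le.trans (le_max_left _ _), h1, h2,
    fun t ht => ?_⟩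
  obtain ⟨hs, b1, b2⟩ := hball (y := t) (by simpa using ht.trans_le (min_le_left _ _))
  have ht1 : ‖t‖ < 1 := ht.trans_le (min_le_right _ _)
  have hne : sinhQuot t ≠ 0 := slitPlane_ne_zero hs
  refine ⟨?_, ?_, ?_, ?_⟩
  · refine ((differentiable_sinhQuot t).hasDerivAt.clog hs).congr_of_eventuallyEq ?_
    filter_upwards [(isOpen_lt continuous_norm continuous_const).mem_nhds ht1] with z hz
    exact gfun_exp_of_norm_lt hz
  · exact (differentiable_deriv_sinhQuot t).hasDerivAt.div
      (differentiable_sinhQuot t).hasDerivAt hne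
  · simp [deriv_sinhQuot_zero] at b1
    simp only [hh1, norm_div]
    exact b1.trans (mul_le_mul_of_nonneg_right (le_max_left _ _) (norm_nonneg _))
  · simp [deriv_sinhQuot_zero, deriv_deriv_sinhQuot_zero, sinhQuot_zero] at b2
    simp only [hh2]
    refine le_trans (le_of_eq ?_)
      (b2.trans (mul_le_mul_of_nonneg_right (le_max_right _ _) (norm_nonneg _)))
    congr 2
    norm_num

/-- `log(1 - p^{-s})`. -/
def logEuler (p : ℕ) (s : ℂ) : ℂ := log (1 - (p : ℂ) ^ (-s))

/-- The first derivative of `logEuler p`. -/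
def logEulerD (p : ℕ) (s : ℂ) : ℂ := log p * (p : ℂ) ^ (-s) / (1 - (p : ℂ) ^ (-s))

/-- The opposite of the second derivative of `logEuler p`. -/
def logEulerDD (p : ℕ) (s : ℂ) : ℂ := log p ^ 2 * (p : ℂ) ^ (-s) / (1 - (p : ℂ) ^ (-s)) ^ 2

theorem one_sub_cpow_neg_mem_slitPlane {p : ℕ} (hp : 2 ≤ p) {s : ℂ} (hs : 0 < s.re) :
    1 - (p : ℂ) ^ (-s) ∈ slitPlane := by
  refine Or.inl ?_
  have h1 : ‖(p : ℂ) ^ (-s)‖ < 1 := by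
    rw [Complex.norm_natCast_cpow_of_pos (by omega)]
    exact Real.rpow_lt_one_of_one_lt_of_neg (by exact_mod_cast hp) (by simpa using hs)
  have h2 := (Complex.re_le_norm ((p : ℂ) ^ (-s)))
  simp only [sub_re, one_re]
  linarith

theorem hasDerivAt_natCast_cpow_neg {p : ℕ} (hp : 2 ≤ p) (s : ℂ) :
    HasDerivAt (fun s => (p : ℂ) ^ (-s)) (-(log p * (p : ℂ) ^ (-s))) s := by
  have hp0 : (p : ℂ) ≠ 0 := by exact_mod_cast (by omega : p ≠ 0)
  have h := (hasDerivAt_id s).neg.const_cpow (c := (p : ℂ)) (Or.inl hp0)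
  refine h.congr_deriv ?_
  simp only [id, Pi.neg_apply]
  ring

theorem hasDerivAt_logEuler {p : ℕ} (hp : 2 ≤ p) {s : ℂ} (hs : 0 < s.re) :
    HasDerivAt (logEuler p) (logEulerD p s) s := by
  refine (((hasDerivAt_natCast_cpow_neg hp s).const_sub 1).clog
    (one_sub_cpow_neg_mem_slitPlane hp hs)).congr_deriv ?_
  rw [logEulerD, neg_neg]

theorem hasDerivAt_logEulerD {p : ℕ} (hp : 2 ≤ p) {s : ℂ} (hs : 0 < s.re) :
    HasDerivAt (logEulerD p) (-logEulerDD p s) s := by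
  have hne := slitPlane_ne_zero (one_sub_cpow_neg_mem_slitPlane hp hs)
  have h := hasDerivAt_natCast_cpow_neg hp s
  refine ((h.const_mul (log p)).div (h.const_sub 1) hne).congr_deriv ?_
  rw [logEulerDD]
  field_simp
  ring

theorem Xi_eq_logEuler {p : ℕ} (hp : 2 ≤ p) {s w : ℂ} (hs : 0 < s.re) (hw : 0 < w.re) :
    Xi ((p : ℂ) ^ (-s)) ((p : ℂ) ^ (-w)) =
      -(2⁻¹ : ℂ) * logEuler p s - (2⁻¹ : ℂ) * logEuler p w -
        gfun (exp (logEuler p s - logEuler p w)) := by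
  rw [Xi, Complex.exp_sub, logEuler, logEuler,
    Complex.exp_log (slitPlane_ne_zero (one_sub_cpow_neg_mem_slitPlane hp hs)),
    Complex.exp_log (slitPlane_ne_zero (one_sub_cpow_neg_mem_slitPlane hp hw))]

theorem eventually_re_pos {s : ℂ} (hs : 0 < s.re) : ∀ᶠ z in nhds s, 0 < z.re :=
  (isOpen_lt continuous_const continuous_re).mem_nhds hs

theorem eventually_norm_logEuler_sub_lt {p : ℕ} (hp : 2 ≤ p) {s : ℂ} (hs : 0 < s.re) {c : ℂ}
    {r : ℝ} (h : ‖logEuler p s - c‖ < r) : ∀ᶠ z in nhds s, ‖logEuler p z - c‖ < r :=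
  ((hasDerivAt_logEuler hp hs).continuousAt.sub continuousAt_const).norm.eventually_lt
    continuousAt_const h

section Derivatives

variable {r : ℝ} {h1 h2 : ℂ → ℂ} {p : ℕ} {s w : ℂ}

theorem hasDerivAt_Xi_left
    (hg : ∀ t : ℂ, ‖t‖ < r → HasDerivAt (fun t => gfun (exp t)) (h1 t) t)
    (hp : 2 ≤ p) (hs : 0 < s.re) (hw : 0 < w.re) (hr : ‖logEuler p s - logEuler p w‖ < r) :
    HasDerivAt (fun z => Xi ((p : ℂ) ^ (-z)) ((p : ℂ) ^ (-w)))
      (-(2⁻¹ : ℂ) * logEulerD p s - h1 (logEuler p s - logEuler p w) * logEulerD p s) s := by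
  have hu := hasDerivAt_logEuler hp hs
  have hc := (hg _ hr).comp s (hu.sub_const (logEuler p w))
  refine (((hu.const_mul (-(2⁻¹ : ℂ))).sub_const (2⁻¹ * logEuler p w)).sub
    hc).congr_of_eventuallyEq ?_
  filter_upwards [eventually_re_pos hs] with z hz
  exact Xi_eq_logEuler hp hz hw

theorem hasDerivAt_Xi_right
    (hg : ∀ t : ℂ, ‖t‖ < r → HasDerivAt (fun t => gfun (exp t)) (h1 t) t)
    (hp : 2 ≤ p) (hs : 0 < s.re) (hw : 0 < w.re) (hr : ‖logEuler p s - logEuler p w‖ < r) :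
    HasDerivAt (fun z => Xi ((p : ℂ) ^ (-s)) ((p : ℂ) ^ (-z)))
      (-(2⁻¹ : ℂ) * logEulerD p w + h1 (logEuler p s - logEuler p w) * logEulerD p w) w := by
  have hu := hasDerivAt_logEuler hp hw
  have hc := (hg _ hr).comp w (hu.const_sub (logEuler p s))
  refine ((((hu.const_mul (2⁻¹ : ℂ)).const_sub (-(2⁻¹ : ℂ) * logEuler p s)).sub
    hc).congr_deriv (by ring)).congr_of_eventuallyEq ?_
  filter_upwards [eventually_re_pos hw] with z hz
  exact Xi_eq_logEuler hp hs hz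

theorem two_le_of_mem_primesLe {y : ℝ} (h : p ∈ primesLe y) : 2 ≤ p :=
  (Finset.mem_filter.1 h).2.two_le

variable {y : ℝ}

theorem pdv_two_zero_fy
    (hg : ∀ t : ℂ, ‖t‖ < r → HasDerivAt (fun t => gfun (exp t)) (h1 t) t)
    (hg' : ∀ t : ℂ, ‖t‖ < r → HasDerivAt h1 (h2 t) t)
    (hs : 0 < s.re) (hw : 0 < w.re)
    (hr : ∀ p ∈ primesLe y, ‖logEuler p s - logEuler p w‖ < r) :
    pdv 2 0 (fy y) s w = ∑ p ∈ primesLe y,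
    (logEulerDD p s / 2 + h1 (logEuler p s - logEuler p w) * logEulerDD p s -
      h2 (logEuler p s - logEuler p w) * logEulerD p s ^ 2) := by
  simp only [pdv, iteratedDeriv_zero]
  rw [iteratedDeriv_succ, iteratedDeriv_one]
  have hev : deriv (fun z => fy y z w) =ᶠ[nhds s] fun z => ∑ p ∈ primesLe y,
      (-(2⁻¹ : ℂ) * logEulerD p z - h1 (logEuler p z - logEuler p w) * logEulerD p z) := by
    filter_upwards [eventually_re_pos hs, (Filter.eventually_all_finset (primesLe y)).2
      fun p hp => eventually_norm_logEuler_sub_lt (two_le_of_mem_primesLe hp) hs (hr p hp)]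
      with z hz hzr
    exact (HasDerivAt.fun_sum fun p hp =>
      hasDerivAt_Xi_left hg (two_le_of_mem_primesLe hp) hz hw (hzr p hp)).deriv
  rw [hev.deriv_eq]
  refine (HasDerivAt.fun_sum fun p hp => ?_).deriv
  have hp2 := two_le_of_mem_primesLe hp
  have hD := hasDerivAt_logEulerD hp2 hs
  have hc := (hg' _ (hr p hp)).comp s ((hasDerivAt_logEuler hp2 hs).sub_const (logEuler p w))
  refine ((hD.const_mul (-(2⁻¹ : ℂ))).sub (hc.mul hD)).congr_deriv ?_
  simp only [Function.comp]
  ring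

theorem pdv_zero_two_fy
    (hg : ∀ t : ℂ, ‖t‖ < r → HasDerivAt (fun t => gfun (exp t)) (h1 t) t)
    (hg' : ∀ t : ℂ, ‖t‖ < r → HasDerivAt h1 (h2 t) t)
    (hs : 0 < s.re) (hw : 0 < w.re)
    (hr : ∀ p ∈ primesLe y, ‖logEuler p s - logEuler p w‖ < r) :
    pdv 0 2 (fy y) s w = ∑ p ∈ primesLe y,
    (logEulerDD p w / 2 - h1 (logEuler p s - logEuler p w) * logEulerDD p w -
      h2 (logEuler p s - logEuler p w) * logEulerD p w ^ 2) := by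
  simp only [pdv, iteratedDeriv_zero]
  rw [iteratedDeriv_succ, iteratedDeriv_one]
  have hev : deriv (fy y s) =ᶠ[nhds w] fun z => ∑ p ∈ primesLe y,
      (-(2⁻¹ : ℂ) * logEulerD p z + h1 (logEuler p s - logEuler p z) * logEulerD p z) := by
    filter_upwards [eventually_re_pos hw, (Filter.eventually_all_finset (primesLe y)).2
      fun p hp => eventually_norm_logEuler_sub_lt (two_le_of_mem_primesLe hp) hw
        ((norm_sub_rev _ _).trans_lt (hr p hp))]
      with z hz hzr
    exact (HasDerivAt.fun_sum fun p hp => hasDerivAt_Xi_right hg (two_le_of_mem_primesLe hp) hs hz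
      ((norm_sub_rev _ _).trans_lt (hzr p hp))).deriv
  rw [hev.deriv_eq]
  refine (HasDerivAt.fun_sum fun p hp => ?_).deriv
  have hp2 := two_le_of_mem_primesLe hp
  have hD := hasDerivAt_logEulerD hp2 hw
  have hc := (hg' _ (hr p hp)).comp w ((hasDerivAt_logEuler hp2 hw).const_sub (logEuler p s))
  refine ((hD.const_mul (-(2⁻¹ : ℂ))).add (hc.mul hD)).congr_deriv ?_
  simp only [Function.comp]
  ring

theorem pdv_one_one_fy
    (hg : ∀ t : ℂ, ‖t‖ < r → HasDerivAt (fun t => gfun (exp t)) (h1 t) t)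
    (hg' : ∀ t : ℂ, ‖t‖ < r → HasDerivAt h1 (h2 t) t)
    (hs : 0 < s.re) (hw : 0 < w.re)
    (hr : ∀ p ∈ primesLe y, ‖logEuler p s - logEuler p w‖ < r) :
    pdv 1 1 (fy y) s w = ∑ p ∈ primesLe y,
    h2 (logEuler p s - logEuler p w) * logEulerD p s * logEulerD p w := by
  simp only [pdv, iteratedDeriv_one]
  have hev : (fun z => deriv (fy y z) w) =ᶠ[nhds s] fun z => ∑ p ∈ primesLe y,
      (-(2⁻¹ : ℂ) * logEulerD p w + h1 (logEuler p z - logEuler p w) * logEulerD p w) := by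
    filter_upwards [eventually_re_pos hs, (Filter.eventually_all_finset (primesLe y)).2
      fun p hp => eventually_norm_logEuler_sub_lt (two_le_of_mem_primesLe hp) hs (hr p hp)]
      with z hz hzr
    exact (HasDerivAt.fun_sum fun p hp =>
      hasDerivAt_Xi_right hg (two_le_of_mem_primesLe hp) hz hw (hzr p hp)).deriv
  rw [hev.deriv_eq]
  refine (HasDerivAt.fun_sum fun p hp => ?_).deriv
  have hp2 := two_le_of_mem_primesLe hp
  have hc := (hg' _ (hr p hp)).comp s ((hasDerivAt_logEuler hp2 hs).sub_const (logEuler p w))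
  exact (hc.mul_const (logEulerD p w)).const_add _

end Derivatives

/-- `log(1 - p^{-σ})` for real `σ`. -/
def logEulerR (p : ℕ) (σ : ℝ) : ℝ := Real.log (1 - (p : ℝ) ^ (-σ))

/-- The first derivative of `logEulerR p`. -/
def logEulerDR (p : ℕ) (σ : ℝ) : ℝ := Real.log p * (p : ℝ) ^ (-σ) / (1 - (p : ℝ) ^ (-σ))

/-- The opposite of the second derivative of `logEulerR p`. -/
def logEulerDDR (p : ℕ) (σ : ℝ) : ℝ :=
  Real.log p ^ 2 * (p : ℝ) ^ (-σ) / (1 - (p : ℝ) ^ (-σ)) ^ 2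

section RealEstimates

variable {p : ℕ} {σ κ α δ : ℝ}

theorem natCast_rpow_neg_pos (hp : 2 ≤ p) : 0 < (p : ℝ) ^ (-σ) :=
  Real.rpow_pos_of_pos (by exact_mod_cast (by omega : 0 < p)) _

theorem natCast_rpow_neg_lt_one (hp : 2 ≤ p) (hσ : 0 < σ) : (p : ℝ) ^ (-σ) < 1 :=
  Real.rpow_lt_one_of_one_lt_of_neg (by exact_mod_cast hp) (by linarith)

theorem natCast_cpow_neg_ofReal : (p : ℂ) ^ (-(σ : ℂ)) = (((p : ℝ) ^ (-σ) : ℝ) : ℂ) := by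
  rw [Complex.ofReal_cpow (by positivity)]
  simp

theorem logEuler_ofReal (hp : 2 ≤ p) (hσ : 0 < σ) :
    logEuler p (σ : ℂ) = (logEulerR p σ : ℂ) := by
  have := natCast_rpow_neg_lt_one hp hσ
  rw [logEuler, logEulerR, natCast_cpow_neg_ofReal, Complex.ofReal_log (by linarith)]
  simp

theorem logEulerD_ofReal : logEulerD p (σ : ℂ) = (logEulerDR p σ : ℂ) := by
  rw [logEulerD, logEulerDR, natCast_cpow_neg_ofReal]
  push_cast
  simp

theorem logEulerDD_ofReal : logEulerDD p (σ : ℂ) = (logEulerDDR p σ : ℂ) := by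
  rw [logEulerDD, logEulerDDR, natCast_cpow_neg_ofReal]
  push_cast
  simp

theorem sigma2_eq_sum (y α : ℝ) : sigma2 y α = ∑ p ∈ primesLe y, logEulerDDR p α := by
  refine Finset.sum_congr rfl fun p hp => ?_
  have h := Real.rpow_pos_of_pos
    (by exact_mod_cast (by linarith [two_le_of_mem_primesLe hp] : 0 < p) : (0 : ℝ) < p) α
  rw [logEulerDDR, Real.rpow_neg (by positivity)]
  rw [show (1 : ℝ) - ((p : ℝ) ^ α)⁻¹ = ((p : ℝ) ^ α - 1) / (p : ℝ) ^ α by field_simp]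
  rw [div_pow, div_div_eq_mul_div]
  congr 1
  field_simp

theorem sigma2t_eq_sum (y α : ℝ) : sigma2t y α = ∑ p ∈ primesLe y, logEulerDR p α ^ 2 := by
  refine Finset.sum_congr rfl fun p hp => ?_
  have h := Real.rpow_pos_of_pos
    (by exact_mod_cast (by linarith [two_le_of_mem_primesLe hp] : 0 < p) : (0 : ℝ) < p) α
  rw [logEulerDR, Real.rpow_neg (by positivity)]
  rw [show (1 : ℝ) - ((p : ℝ) ^ α)⁻¹ = ((p : ℝ) ^ α - 1) / (p : ℝ) ^ α by field_simp]
  rw [div_div_eq_mul_div, div_pow]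
  congr 1
  field_simp

theorem logEulerR_mono (hp : 2 ≤ p) (hκ : 0 < κ) (h : κ ≤ σ) :
    logEulerR p κ ≤ logEulerR p σ := by
  have h1 := natCast_rpow_neg_lt_one hp hκ
  refine Real.log_le_log (by linarith) ?_
  have : (p : ℝ) ^ (-σ) ≤ (p : ℝ) ^ (-κ) :=
    Real.rpow_le_rpow_of_exponent_le (by exact_mod_cast (by omega : 1 ≤ p)) (by linarith)
  linarith

theorem logEulerR_sub_le_two (hp : 2 ≤ p) (hκ : 0 < κ) (h : κ ≤ σ) :
    logEulerR p σ - logEulerR p κ ≤ logEulerR 2 σ - logEulerR 2 κ := by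
  have hσ : 0 < σ := hκ.trans_le h
  have hp1 := natCast_rpow_neg_lt_one hp hκ
  have hp2 := natCast_rpow_neg_lt_one hp hσ
  have h21 := natCast_rpow_neg_lt_one le_rfl hκ
  have h22 := natCast_rpow_neg_lt_one le_rfl hσ
  have hle : (p : ℝ) ^ (-κ) ≤ ((2 : ℕ) : ℝ) ^ (-κ) :=
    Real.rpow_le_rpow_of_nonpos (by norm_num) (by exact_mod_cast hp) (by linarith)
  have hpow (n : ℕ) : ((n : ℝ) ^ (-κ)) ^ (σ / κ) = (n : ℝ) ^ (-σ) := by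
    rw [← Real.rpow_mul (by positivity)]
    congr 1
    field_simp
  have hflip (a b : ℝ) : (a - 1) / (b - 1) = (1 - a) / (1 - b) := by
    rw [← neg_div_neg_eq, neg_sub, neg_sub]
  have hsec := (convexOn_rpow ((one_le_div hκ).2 h)).secant_mono (a := 1)
    (x := (p : ℝ) ^ (-κ)) (y := ((2 : ℕ) : ℝ) ^ (-κ)) (by simp)
    (natCast_rpow_neg_pos hp).le (natCast_rpow_neg_pos le_rfl).le hp1.ne h21.ne hle
  simp only [hpow, Real.one_rpow] at hsec
  rw [hflip, hflip] at hsec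
  simp only [logEulerR]
  rw [← Real.log_div (by linarith) (by linarith), ← Real.log_div (by linarith) (by linarith)]
  exact Real.log_le_log (div_pos (by linarith) (by linarith)) hsec

theorem abs_logEulerR_sub_le (hp : 2 ≤ p) (hσ : 0 < σ) (hκ : 0 < κ) :
    |logEulerR p σ - logEulerR p κ| ≤ |logEulerR 2 σ - logEulerR 2 κ| := by
  have key {σ κ : ℝ} (hκ : 0 < κ) (h : κ ≤ σ) :
      |logEulerR p σ - logEulerR p κ| ≤ |logEulerR 2 σ - logEulerR 2 κ| := by
    rw [abs_of_nonneg (sub_nonneg.2 (logEulerR_mono hp hκ h))]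
    exact (logEulerR_sub_le_two hp hκ h).trans (le_abs_self _)
  rcases le_total κ σ with h | h
  · exact key hκ h
  · rw [abs_sub_comm, abs_sub_comm (logEulerR 2 σ)]
    exact key hσ h

theorem abs_logEulerR_two_sub_le (hσ : 0 < σ) (hκ : 0 < κ) (hδ : 0 ≤ δ)
    (h1 : 1 / (1 + δ) ≤ (1 - (2 : ℝ) ^ (-σ)) / (1 - (2 : ℝ) ^ (-κ)))
    (h2 : (1 - (2 : ℝ) ^ (-σ)) / (1 - (2 : ℝ) ^ (-κ)) ≤ 1 + δ) :
    |logEulerR 2 σ - logEulerR 2 κ| ≤ δ := by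
  have h21 := natCast_rpow_neg_lt_one le_rfl hκ
  have h22 := natCast_rpow_neg_lt_one le_rfl hσ
  have hlog : Real.log (1 + δ) ≤ δ := by
    linarith [Real.log_le_sub_one_of_pos (by linarith : 0 < 1 + δ)]
  simp only [logEulerR]
  rw [← Real.log_div (by linarith) (by linarith)]
  push_cast at h21 h22 ⊢
  have hpos : 0 < (1 - (2 : ℝ) ^ (-σ)) / (1 - (2 : ℝ) ^ (-κ)) :=
    div_pos (by linarith) (by linarith)
  have h3 := Real.log_le_log hpos h2
  have h4 := Real.log_le_log (by positivity) h1
  rw [one_div, Real.log_inv] at h4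
  exact abs_le.2 ⟨by linarith, by linarith⟩

theorem abs_exp_sub_one_mul_le {a θ ε : ℝ} (ha : 0 ≤ a) (hθ : |θ| ≤ ε) (hε : ε ≤ 1) :
    |a * Real.exp θ - a| ≤ 2 * ε * a := by
  have h := Real.abs_exp_sub_one_le (hθ.trans hε)
  rw [show a * Real.exp θ - a = a * (Real.exp θ - 1) by ring, abs_mul, abs_of_nonneg ha]
  nlinarith

theorem natCast_rpow_neg_eq_mul_exp (hp : 2 ≤ p) :
    (p : ℝ) ^ (-σ) = (p : ℝ) ^ (-α) * Real.exp ((α - σ) * Real.log p) := by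
  have hp0 : (0 : ℝ) < p := by exact_mod_cast (by omega : 0 < p)
  rw [Real.rpow_def_of_pos hp0, Real.rpow_def_of_pos hp0, ← Real.exp_add]
  congr 1
  ring

theorem one_sub_natCast_rpow_neg_eq_mul_exp (hp : 2 ≤ p) (hσ : 0 < σ) (hα : 0 < α) :
    1 - (p : ℝ) ^ (-σ) =
      (1 - (p : ℝ) ^ (-α)) / Real.exp (logEulerR p α - logEulerR p σ) := by
  have h1 := natCast_rpow_neg_lt_one hp hσ
  have h2 := natCast_rpow_neg_lt_one hp hα
  rw [Real.exp_sub, logEulerR, logEulerR, Real.exp_log (by linarith), Real.exp_log (by linarith)]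
  have : 1 - (p : ℝ) ^ (-α) ≠ 0 := by linarith
  field_simp

theorem logEulerDR_nonneg (hp : 2 ≤ p) (hα : 0 < α) : 0 ≤ logEulerDR p α := by
  have h2 := natCast_rpow_neg_lt_one hp hα
  exact div_nonneg (mul_nonneg (Real.log_natCast_nonneg p) (natCast_rpow_neg_pos hp).le)
    (by linarith)

theorem logEulerDR_sq_le (hp : 2 ≤ p) (hα : 0 < α) : logEulerDR p α ^ 2 ≤ logEulerDDR p α := by
  have h1 := natCast_rpow_neg_pos (σ := α) hp
  have h2 := natCast_rpow_neg_lt_one hp hα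
  rw [logEulerDR, logEulerDDR, div_pow, mul_pow]
  gcongr
  nlinarith

theorem abs_logEulerDR_sub_le (hp : 2 ≤ p) (hσ : 0 < σ) (hα : 0 < α)
    (h1 : |(α - σ) * Real.log p| ≤ δ) (h2 : |logEulerR p α - logEulerR p σ| ≤ δ)
    (hδ : δ ≤ 1 / 3) : |logEulerDR p σ - logEulerDR p α| ≤ 4 * δ * logEulerDR p α := by
  have hδ0 : 0 ≤ δ := (abs_nonneg _).trans h1
  have heq : logEulerDR p σ = logEulerDR p α *
      Real.exp ((α - σ) * Real.log p + (logEulerR p α - logEulerR p σ)) := by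
    rw [logEulerDR, one_sub_natCast_rpow_neg_eq_mul_exp hp hσ hα,
      natCast_rpow_neg_eq_mul_exp (α := α) hp, Real.exp_add, logEulerDR]
    field_simp
  rw [heq]
  refine (abs_exp_sub_one_mul_le (ε := 2 * δ) (logEulerDR_nonneg hp hα) ?_
    (by linarith)).trans_eq (by ring)
  exact (abs_add_le _ _).trans (by linarith)

theorem abs_logEulerDDR_sub_le (hp : 2 ≤ p) (hσ : 0 < σ) (hα : 0 < α)
    (h1 : |(α - σ) * Real.log p| ≤ δ) (h2 : |logEulerR p α - logEulerR p σ| ≤ δ)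
    (hδ : δ ≤ 1 / 3) : |logEulerDDR p σ - logEulerDDR p α| ≤ 6 * δ * logEulerDDR p α := by
  have heq : logEulerDDR p σ = logEulerDDR p α *
      Real.exp ((α - σ) * Real.log p + ((logEulerR p α - logEulerR p σ) +
        (logEulerR p α - logEulerR p σ))) := by
    rw [logEulerDDR, one_sub_natCast_rpow_neg_eq_mul_exp hp hσ hα,
      natCast_rpow_neg_eq_mul_exp (α := α) hp, Real.exp_add,
      Real.exp_add (logEulerR p α - logEulerR p σ), logEulerDDR]
    field_simp
  rw [heq]
  refine (abs_exp_sub_one_mul_le (ε := 3 * δ)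
    ((sq_nonneg _).trans (logEulerDR_sq_le hp hα)) ?_ (by linarith)).trans_eq (by ring)
  have h3 := abs_add_le ((α - σ) * Real.log p)
    ((logEulerR p α - logEulerR p σ) + (logEulerR p α - logEulerR p σ))
  have h4 := abs_add_le (logEulerR p α - logEulerR p σ) (logEulerR p α - logEulerR p σ)
  linarith

/-- A monotone function moves less between `σ` and an intermediate `α` than from `σ` to `κ`. -/
theorem abs_sub_le_of_between {φ : ℝ → ℝ} (hφ : MonotoneOn φ (Set.Ioi 0)) (hσ : 0 < σ)
    (hκ : 0 < κ) (hα : 0 < α) (h : 0 ≤ (σ - α) * (α - κ)) :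
    |φ α - φ σ| ≤ |φ σ - φ κ| ∧ |φ α - φ κ| ≤ |φ σ - φ κ| := by
  have key : ∀ a b c : ℝ, (a ≤ b ∧ b ≤ c) ∨ (c ≤ b ∧ b ≤ a) →
      |b - a| ≤ |a - c| ∧ |b - c| ≤ |a - c| := by
    intro a b c h
    grind
  refine key _ _ _ ?_
  rcases mul_nonneg_iff.1 h with ⟨h1, h2⟩ | ⟨h1, h2⟩
  · exact Or.inr ⟨hφ hκ hα (by linarith), hφ hα hσ (by linarith)⟩
  · exact Or.inl ⟨hφ hσ hα (by linarith), hφ hα hκ (by linarith)⟩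

end RealEstimates

section TermEstimates

variable {a a₁ a₂ b b₁ δ K : ℝ} {z₁ z₂ : ℂ}

theorem norm_mul_mul_sub_le (ha : 0 ≤ a) (hab : a ^ 2 ≤ b) (h₁ : |a₁ - a| ≤ 4 * δ * a)
    (h₂ : |a₂ - a| ≤ 4 * δ * a) (hδ : δ ≤ 1 / 3) (hδ0 : 0 ≤ δ) (hK : 0 ≤ K)
    (hz : ‖z₂ - 1 / 12‖ ≤ K * δ) :
    ‖z₂ * a₁ * a₂ - (a : ℂ) ^ 2 / 12‖ ≤ (9 * K + 2) * δ * b := by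
  have e : z₂ * a₁ * a₂ - (a : ℂ) ^ 2 / 12 =
      (z₂ - 1 / 12) * ((a₁ * a₂ : ℝ) : ℂ) + ((((a₁ - a) * a₂ + a * (a₂ - a)) / 12 : ℝ) : ℂ) := by
    push_cast
    ring
  have habs {c : ℝ} (h : |c - a| ≤ 4 * δ * a) : |c| ≤ 3 * a := by
    have h3 := abs_add_le (c - a) a
    rw [sub_add_cancel, abs_of_nonneg ha] at h3
    nlinarith
  have hb₁ := habs h₁
  have hb₂ := habs h₂
  have hb : 0 ≤ b := (sq_nonneg a).trans hab
  rw [e]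
  refine (norm_add_le _ _).trans ?_
  rw [norm_mul, norm_real, norm_real, Real.norm_eq_abs, Real.norm_eq_abs, abs_mul, abs_div]
  have t1 : ‖z₂ - 1 / 12‖ * (|a₁| * |a₂|) ≤ K * δ * (9 * b) := by
    refine mul_le_mul hz ?_ (by positivity) (by positivity)
    calc |a₁| * |a₂| ≤ (3 * a) * (3 * a) := mul_le_mul hb₁ hb₂ (abs_nonneg _) (by positivity)
      _ ≤ 9 * b := by nlinarith
  have t2 : |(a₁ - a) * a₂ + a * (a₂ - a)| ≤ 16 * δ * b := by
    refine (abs_add_le _ _).trans ?_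
    rw [abs_mul, abs_mul, abs_of_nonneg ha]
    calc |a₁ - a| * |a₂| + a * |a₂ - a| ≤ (4 * δ * a) * (3 * a) + a * (4 * δ * a) := by
          gcongr
      _ = 16 * δ * a ^ 2 := by ring
      _ ≤ 16 * δ * b := by gcongr
  rw [abs_of_pos (by norm_num : (0 : ℝ) < 12)]
  have := mul_nonneg hδ0 hb
  nlinarith

theorem norm_half_add_mul_sub_mul_sq_sub_le (ha : 0 ≤ a) (hab : a ^ 2 ≤ b)
    (h₁ : |a₁ - a| ≤ 4 * δ * a) (hb₁ : |b₁ - b| ≤ 6 * δ * b) (hδ : δ ≤ 1 / 3) (hδ0 : 0 ≤ δ)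
    (hK : 0 ≤ K) (hz₁ : ‖z₁‖ ≤ K * δ) (hz : ‖z₂ - 1 / 12‖ ≤ K * δ) :
    ‖(b₁ : ℂ) / 2 + z₁ * b₁ - z₂ * a₁ ^ 2 - ((b : ℂ) / 2 - (a : ℂ) ^ 2 / 12)‖ ≤
      (12 * K + 5) * δ * b := by
  have hb : 0 ≤ b := (sq_nonneg a).trans hab
  have e : (b₁ : ℂ) / 2 + z₁ * b₁ - z₂ * a₁ ^ 2 - ((b : ℂ) / 2 - (a : ℂ) ^ 2 / 12) =
      (((b₁ - b) / 2 : ℝ) : ℂ) + z₁ * b₁ - (z₂ * a₁ * a₁ - (a : ℂ) ^ 2 / 12) := by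
    push_cast
    ring
  have h3 := norm_mul_mul_sub_le ha hab h₁ h₁ hδ hδ0 hK hz
  have hbabs : |b₁| ≤ 3 * b := by
    have h3 := abs_add_le (b₁ - b) b
    rw [sub_add_cancel, abs_of_nonneg hb] at h3
    nlinarith
  rw [e]
  refine (norm_sub_le _ _).trans ((add_le_add (norm_add_le _ _) h3).trans ?_)
  rw [norm_mul, norm_real, norm_real, Real.norm_eq_abs, Real.norm_eq_abs, abs_div,
    abs_of_pos (by norm_num : (0 : ℝ) < 2)]
  have t1 : ‖z₁‖ * |b₁| ≤ K * δ * (3 * b) :=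
    mul_le_mul hz₁ hbabs (abs_nonneg _) (by positivity)
  linarith

theorem norm_mul_sub_sq_sub_le {X Y Z : ℂ} {A B S ε : ℝ} (hA : |A| ≤ S) (hB : |B| ≤ S)
    (hX : ‖X - A‖ ≤ ε * S) (hY : ‖Y - A‖ ≤ ε * S) (hZ : ‖Z - B‖ ≤ ε * S) (hε : 0 ≤ ε) :
    ‖X * Y - Z ^ 2 - ((A ^ 2 - B ^ 2 : ℝ) : ℂ)‖ ≤ (4 * ε + 2 * ε ^ 2) * S ^ 2 := by
  have hS : 0 ≤ S := (abs_nonneg _).trans hA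
  have e : X * Y - Z ^ 2 - ((A ^ 2 - B ^ 2 : ℝ) : ℂ) =
      ((A : ℂ) * (X - A) + A * (Y - A) + (X - A) * (Y - A)) -
        ((B : ℂ) * (Z - B) + B * (Z - B) + (Z - B) * (Z - B)) := by
    push_cast
    ring
  have key {D : ℝ} {U V : ℂ} (hD : |D| ≤ S) (hU : ‖U‖ ≤ ε * S) (hV : ‖V‖ ≤ ε * S) :
      ‖(D : ℂ) * U + D * V + U * V‖ ≤ (2 * ε + ε ^ 2) * S ^ 2 := by
    refine (norm_add₃_le).trans ?_
    simp only [norm_mul, norm_real, Real.norm_eq_abs]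
    calc |D| * ‖U‖ + |D| * ‖V‖ + ‖U‖ * ‖V‖
        ≤ S * (ε * S) + S * (ε * S) + (ε * S) * (ε * S) := by gcongr
      _ = _ := by ring
  rw [e]
  refine (norm_sub_le _ _).trans ((add_le_add (key hA hX hY) (key hB hZ hZ)).trans_eq ?_)
  ring

end TermEstimates

/-- Lemma 4.(iv): on `D_δ(α;y)` with `0 ≤ δ ≤ δ₀`,
`∂₂₀f_y + ∂₁₁f_y = σ₂/2 + O(δσ₂)` and `Hess[f_y] = (σ₂/4)(σ₂ − σ̃₂/3) + O(δσ₂²)`. -/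
theorem stmt12 :
    ∃ δ₀ > (0 : ℝ), ∃ C > (0 : ℝ), ∀ x y α δ σ κ : ℝ,
      2 ≤ y → y ≤ x → 0 < α → saddleEq x y α →
      0 ≤ δ → δ ≤ δ₀ → (σ, κ) ∈ Ddom δ α y →
      |(pdv 2 0 (fy y) (σ : ℂ) (κ : ℂ)).re + (pdv 1 1 (fy y) (σ : ℂ) (κ : ℂ)).re -
          sigma2 y α / 2| ≤ C * δ * sigma2 y α ∧
      |(HessC y (σ : ℂ) (κ : ℂ)).re -
          (sigma2 y α / 4) * (sigma2 y α - sigma2t y α / 3)| ≤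
        C * δ * (sigma2 y α) ^ 2 := by
  obtain ⟨r, hr, K, hK, h1, h2, hh⟩ := exists_derivs_gfun_exp
  have hg := fun t ht => (hh t ht).1
  have hg' := fun t ht => (hh t ht).2.1
  set M : ℝ := 12 * K + 5 with hM
  have hMpos : 0 < M := by positivity
  refine ⟨min (r / 2) (1 / 3), by positivity, 4 * M + 2 * M ^ 2, by positivity, ?_⟩
  intro x y α δ σ κ hy _ hα _ hδ0 hδ hD
  obtain ⟨hσ, -, hκ, -, hbet, hlo, hhi, hlog⟩ := hD
  simp only at hσ hκ hbet hlo hhi hlog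
  have hδr : δ < r := by linarith [hδ.trans (min_le_left _ _)]
  have hδ3 : δ ≤ 1 / 3 := hδ.trans (min_le_right _ _)
  have hs : 0 < (σ : ℂ).re := by simpa using hσ
  have hw : 0 < (κ : ℂ).re := by simpa using hκ
  have hu (p : ℕ) (hp : p ∈ primesLe y) : |logEulerR p σ - logEulerR p κ| ≤ δ :=
    (abs_logEulerR_sub_le (two_le_of_mem_primesLe hp) hσ hκ).trans
      (abs_logEulerR_two_sub_le hσ hκ hδ0 hlo hhi)
  have hnorm (p : ℕ) (hp : p ∈ primesLe y) : ‖logEuler p σ - logEuler p κ‖ ≤ δ := by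
    have hp2 := two_le_of_mem_primesLe hp
    rw [logEuler_ofReal hp2 hσ, logEuler_ofReal hp2 hκ, ← ofReal_sub, norm_real]
    exact hu p hp
  have hnr (p : ℕ) (hp : p ∈ primesLe y) : ‖logEuler p σ - logEuler p κ‖ < r :=
    (hnorm p hp).trans_lt hδr
  have hz1 (p : ℕ) (hp : p ∈ primesLe y) : ‖h1 (logEuler p σ - logEuler p κ)‖ ≤ K * δ :=
    (hh _ (hnr p hp)).2.2.1.trans (mul_le_mul_of_nonneg_left (hnorm p hp) hK)
  have hz2 (p : ℕ) (hp : p ∈ primesLe y) :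
      ‖h2 (logEuler p σ - logEuler p κ) - 1 / 12‖ ≤ K * δ :=
    (hh _ (hnr p hp)).2.2.2.trans (mul_le_mul_of_nonneg_left (hnorm p hp) hK)
  have hlogp (p : ℕ) (hp : p ∈ primesLe y) : |σ - κ| * Real.log p ≤ δ := by
    refine le_trans (mul_le_mul_of_nonneg_left (Real.log_le_log ?_ ?_) (abs_nonneg _)) hlog
    · exact_mod_cast (by linarith [two_le_of_mem_primesLe hp] : 0 < p)
    · exact (Nat.le_floor_iff (by linarith)).1 (Finset.mem_Iic.1 (Finset.mem_filter.1 hp).1)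
  have hid := abs_sub_le_of_between (monotone_id.monotoneOn _) hσ hκ hα hbet
  simp only [id] at hid
  have hlσ (p : ℕ) (hp : p ∈ primesLe y) : |(α - σ) * Real.log p| ≤ δ := by
    rw [abs_mul, abs_of_nonneg (Real.log_natCast_nonneg p)]
    exact (mul_le_mul_of_nonneg_right hid.1 (Real.log_natCast_nonneg p)).trans (hlogp p hp)
  have hlκ (p : ℕ) (hp : p ∈ primesLe y) : |(α - κ) * Real.log p| ≤ δ := by
    rw [abs_mul, abs_of_nonneg (Real.log_natCast_nonneg p)]
    exact (mul_le_mul_of_nonneg_right hid.2 (Real.log_natCast_nonneg p)).trans (hlogp p hp)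
  have hub (p : ℕ) (hp : p ∈ primesLe y) := abs_sub_le_of_between (φ := logEulerR p)
    (fun _ ha _ _ hab => logEulerR_mono (two_le_of_mem_primesLe hp) ha hab) hσ hκ hα hbet
  have haσ (p : ℕ) (hp : p ∈ primesLe y) := abs_logEulerDR_sub_le
    (two_le_of_mem_primesLe hp) hσ hα (hlσ p hp) ((hub p hp).1.trans (hu p hp)) hδ3
  have haκ (p : ℕ) (hp : p ∈ primesLe y) := abs_logEulerDR_sub_le
    (two_le_of_mem_primesLe hp) hκ hα (hlκ p hp) ((hub p hp).2.trans (hu p hp)) hδ3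
  have hbσ (p : ℕ) (hp : p ∈ primesLe y) := abs_logEulerDDR_sub_le
    (two_le_of_mem_primesLe hp) hσ hα (hlσ p hp) ((hub p hp).1.trans (hu p hp)) hδ3
  have hbκ (p : ℕ) (hp : p ∈ primesLe y) := abs_logEulerDDR_sub_le
    (two_le_of_mem_primesLe hp) hκ hα (hlκ p hp) ((hub p hp).2.trans (hu p hp)) hδ3
  have ha0 (p : ℕ) (hp : p ∈ primesLe y) :=
    logEulerDR_nonneg (two_le_of_mem_primesLe hp) hα
  have hab (p : ℕ) (hp : p ∈ primesLe y) :=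
    logEulerDR_sq_le (two_le_of_mem_primesLe hp) hα
  set S := sigma2 y α with hS
  set T := sigma2t y α with hT
  have hT0 : 0 ≤ T := by
    rw [hT, sigma2t_eq_sum]
    exact Finset.sum_nonneg fun p _ => sq_nonneg _
  have hTS : T ≤ S := by
    rw [hT, hS, sigma2t_eq_sum, sigma2_eq_sum]
    exact Finset.sum_le_sum hab
  have hA : ((S / 2 - T / 12 : ℝ) : ℂ) = ∑ p ∈ primesLe y,
      ((logEulerDDR p α : ℂ) / 2 - (logEulerDR p α : ℂ) ^ 2 / 12) := by
    rw [hS, hT, sigma2_eq_sum, sigma2t_eq_sum, Finset.sum_sub_distrib, ← Finset.sum_div,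
      ← Finset.sum_div]
    push_cast
    rfl
  have hB : ((T / 12 : ℝ) : ℂ) = ∑ p ∈ primesLe y, (logEulerDR p α : ℂ) ^ 2 / 12 := by
    rw [hT, sigma2t_eq_sum, ← Finset.sum_div]
    push_cast
    rfl
  have hX : ‖pdv 2 0 (fy y) σ κ - ((S / 2 - T / 12 : ℝ) : ℂ)‖ ≤ (M * δ) * S := by
    rw [pdv_two_zero_fy hg hg' hs hw hnr, hA, ← Finset.sum_sub_distrib, hS, sigma2_eq_sum,
      Finset.mul_sum]
    refine norm_sum_le_of_le _ fun p hp => ?_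
    rw [logEulerDD_ofReal, logEulerD_ofReal]
    exact norm_half_add_mul_sub_mul_sq_sub_le (ha0 p hp) (hab p hp) (haσ p hp) (hbσ p hp) hδ3 hδ0
      hK (hz1 p hp) (hz2 p hp)
  have hY : ‖pdv 0 2 (fy y) σ κ - ((S / 2 - T / 12 : ℝ) : ℂ)‖ ≤ (M * δ) * S := by
    rw [pdv_zero_two_fy hg hg' hs hw hnr, hA, ← Finset.sum_sub_distrib, hS, sigma2_eq_sum,
      Finset.mul_sum]
    refine norm_sum_le_of_le _ fun p hp => ?_
    rw [logEulerDD_ofReal, logEulerD_ofReal, sub_eq_add_neg (_ / 2 : ℂ), ← neg_mul]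
    exact norm_half_add_mul_sub_mul_sq_sub_le (ha0 p hp) (hab p hp) (haκ p hp) (hbκ p hp) hδ3 hδ0
      hK ((norm_neg _).trans_le (hz1 p hp)) (hz2 p hp)
  have hZ : ‖pdv 1 1 (fy y) σ κ - ((T / 12 : ℝ) : ℂ)‖ ≤ (M * δ) * S := by
    rw [pdv_one_one_fy hg hg' hs hw hnr, hB, ← Finset.sum_sub_distrib, hS, sigma2_eq_sum,
      Finset.mul_sum]
    refine norm_sum_le_of_le _ fun p hp => ?_
    rw [logEulerD_ofReal, logEulerD_ofReal]
    refine (norm_mul_mul_sub_le (ha0 p hp) (hab p hp) (haσ p hp) (haκ p hp) hδ3 hδ0 hK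
      (hz2 p hp)).trans ?_
    have hb : 0 ≤ logEulerDDR p α := (sq_nonneg _).trans (hab p hp)
    gcongr
    rw [hM]
    linarith
  constructor
  · have hre := Complex.abs_re_le_norm (pdv 2 0 (fy y) σ κ - ((S / 2 - T / 12 : ℝ) : ℂ))
    have hre' := Complex.abs_re_le_norm (pdv 1 1 (fy y) σ κ - ((T / 12 : ℝ) : ℂ))
    rw [sub_re, ofReal_re] at hre hre'
    calc _ = |((pdv 2 0 (fy y) σ κ).re - (S / 2 - T / 12)) +
          ((pdv 1 1 (fy y) σ κ).re - T / 12)| := by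
          congr 1
          ring
      _ ≤ M * δ * S + M * δ * S :=
          (abs_add_le _ _).trans (add_le_add (hre.trans hX) (hre'.trans hZ))
      _ = 2 * M * δ * S := by ring
      _ ≤ (4 * M + 2 * M ^ 2) * δ * S := by
          have : 0 ≤ S := hT0.trans hTS
          gcongr
          nlinarith
  · have hH := norm_mul_sub_sq_sub_le (S := S) (abs_le.2 ⟨by linarith, by linarith⟩)
      (abs_le.2 ⟨by linarith, by linarith⟩) hX hY hZ (by positivity)
    have hre := (Complex.abs_re_le_norm _).trans hH
    rw [sub_re, ofReal_re] at hre
    rw [show S / 4 * (S - T / 3) = (S / 2 - T / 12) ^ 2 - (T / 12) ^ 2 by ring]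
    refine hre.trans (mul_le_mul_of_nonneg_right ?_ (sq_nonneg _))
    have : δ ^ 2 ≤ δ := by nlinarith
    nlinarith [mul_le_mul_of_nonneg_left this (sq_nonneg M)]

end
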